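/- arXiv:1909.04023 — 3 statements merged into one kernel-verified Lean document; each statement's English description precedes it below -/
import Mathlib

section
/- Let k be a field of characteristic zero, let R be a finitely generated commutative k-algebra that is an integral domain of Krull dimension one, and let δ be a k-linear derivation of R. Let T be a skew polynomial ring R[x;δ]: a k-algebra equipped with an injective k-algebra homomorphism ι : R → T and an element x ∈ T such that every element of T is uniquely a finite sum Σ_i ι(r_i)x^i with r_i ∈ R, and x·ι(r) = ι(r)·x + ι(δ(r)) for all r ∈ R. Then either (i) there is a k-subalgebra k' of R which is a field, finite-dimensional over k, with R isomorphic as a k-algebra to the polynomial ring k'[t]; or (ii) ML(T) = R, i.e., the set of elements of T annihilated by every locally nilpotent k-linear derivation of T is exactly the image ι(R). -/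
section
open Polynomial

lemma krull_le_of_integral {A B : Type*} [CommRing A] [CommRing B] [Algebra A B]
    [Algebra.IsIntegral A B] (hinj : Function.Injective (algebraMap A B)) (n : ℕ)
    (h : (n : WithBot ℕ∞) ≤ ringKrullDim A) : (n : WithBot ℕ∞) ≤ ringKrullDim B := by
  unfold ringKrullDim at *
  rw [Order.le_krullDim_iff] at *
  obtain ⟨l, hl⟩ := h
  have : FaithfulSMul A B := (faithfulSMul_iff_algebraMap_injective A B).mpr hinj
  obtain ⟨Q, hQ, hQ2⟩ := Ideal.nonempty_primesOver (S := B) (RelSeries.head l).asIdeal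
  obtain ⟨L, hL, -⟩ := Ideal.exists_ltSeries_of_hasGoingUp l Q
  exact ⟨L, hL.trans hl⟩

lemma trdeg_le_one {k R : Type*} [Field k] [CommRing R] [IsDomain R] [Algebra k R]
    (hfg : Algebra.FiniteType k R) (hdim : ringKrullDim R = 1) : Algebra.trdeg k R ≤ 1 := by
  obtain ⟨s, g, hg, hgi⟩ := exists_integral_inj_algHom_of_fg k R
  have hs : s ≤ 1 := by
    let := g.toRingHom.toAlgebra
    have : Algebra.IsIntegral (MvPolynomial (Fin s) k) R := ⟨hgi⟩
    have := krull_le_of_integral (A := MvPolynomial (Fin s) k) (B := R) hg s (by simp)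
    rw [hdim] at this
    exact_mod_cast this
  have hr : Algebra.adjoin k (Set.range (fun i => g (MvPolynomial.X i))) = g.range := by
    rw [← Algebra.map_top g, ← MvPolynomial.adjoin_range_X, AlgHom.map_adjoin, ← Set.range_comp]
    rfl
  have : Algebra.IsAlgebraic
      (Algebra.adjoin k (Set.range (fun i => g (MvPolynomial.X i)))) R := by
    rw [hr]
    refine ⟨fun r => ?_⟩
    obtain ⟨p, hp, hp2⟩ := hgi r
    refine ⟨p.map (g.rangeRestrict.toRingHom), (hp.map _).ne_zero, ?_⟩
    rw [Polynomial.aeval_def, Polynomial.eval₂_map]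
    exact hp2
  refine (Algebra.IsAlgebraic.trdeg_le_cardinalMk k
    (Set.range (fun i => g (MvPolynomial.X i)))).trans ?_
  refine Cardinal.mk_le_one_iff_set_subsingleton.mpr ?_
  have : Subsingleton (Fin s) := Fin.subsingleton_iff_le_one.mpr hs
  exact Set.subsingleton_range _

lemma exists_antideriv {k K : Type*} [Field k] [CharZero k] [CommRing K] [Algebra k K]
    (P : K[X]) : ∃ Q : K[X], derivative Q = P := by
  induction P using Polynomial.induction_on' with
  | add p q hp hq =>
    obtain ⟨a, rfl⟩ := hp
    obtain ⟨b, rfl⟩ := hq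
    exact ⟨a + b, by simp⟩
  | monomial n a =>
    refine ⟨monomial (n+1) (algebraMap k K ((n+1 : k)⁻¹) * a), ?_⟩
    rw [derivative_monomial]
    congr 1
    have h : ((n+1 : k)⁻¹) * (n+1) = 1 := inv_mul_cancel₀ (Nat.cast_add_one_ne_zero n)
    have := congrArg (algebraMap k K) h
    simp only [map_mul, map_add, map_natCast, map_one] at this
    push_cast
    linear_combination a * this

lemma transc_of_deriv {K R : Type*} [CommRing K] [IsDomain K] [CharZero K] [CommRing R] [IsDomain R]
    [Algebra K R] (hinj : Function.Injective (algebraMap K R))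
    (D : Derivation K R R) (a : R) (ha : D a ≠ 0) : Transcendental K a := by
  rw [transcendental_iff]
  suffices ∀ n, ∀ p : K[X], p.natDegree ≤ n → aeval a p = 0 → p = 0 from
    fun p hp => this _ p le_rfl hp
  intro n
  have hconst : ∀ p : K[X], p.natDegree = 0 → aeval a p = 0 → p = 0 := by
    intro p hp h
    obtain ⟨c, rfl⟩ := natDegree_eq_zero.mp hp
    rw [aeval_C] at h
    rw [hinj (h.trans (map_zero _).symm), map_zero]
  induction n with
  | zero => intro p hp h; exact hconst p (by omega) h
  | succ n ih =>
    intro p hp h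
    have h2 : aeval a (derivative p) = 0 := by
      have := D.map_aeval p a
      rw [h, map_zero, smul_eq_mul] at this
      exact (mul_eq_zero.mp this.symm).resolve_right ha
    have h3 := ih (derivative p) ((natDegree_derivative_le p).trans (by omega)) h2
    exact hconst p (derivative_eq_zero.mp h3) h

lemma lnd_case {k R : Type*} [Field k] [CharZero k] [CommRing R] [IsDomain R] [Algebra k R]
    (hfg : Algebra.FiniteType k R) (hdim : ringKrullDim R = 1) (D : Derivation k R R)
    (hD : ∀ a, ∃ n, D^[n] a = 0) (hne : ∃ a, D a ≠ 0) :
    ∃ k' : Subalgebra k R, IsField k' ∧ FiniteDimensional k k' ∧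
        Nonempty (R ≃ₐ[k] Polynomial k') := by
  classical
  let K : Subalgebra k R :=
    { carrier := {a | D a = 0}
      mul_mem' := by intro a b ha hb; simp_all
      add_mem' := by intro a b ha hb; simp_all
      algebraMap_mem' := by intro r; simp }
  have hK : ∀ a, a ∈ K ↔ D a = 0 := fun a => Iff.rfl
  let D' : Derivation K R R := Derivation.mk'
    { toFun := D
      map_add' := by simp
      map_smul' := by
        intro m r
        have := (hK m).1 m.2
        simp [Algebra.smul_def, this] } (by intro a b; simp)
  have hD' : ∀ a, D' a = D a := fun a => rfl
  have : CharZero R := charZero_of_injective_algebraMap (algebraMap k R).injective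
  have : CharZero K := charZero_of_injective_algebraMap (algebraMap k K).injective
  have hinj : Function.Injective (algebraMap K R) := Subtype.val_injective
  obtain ⟨a, ha, ha2⟩ : ∃ a, D a ≠ 0 ∧ D (D a) = 0 := by
    obtain ⟨a, ha⟩ := hne
    have hex := hD a
    have h0 := Nat.find_spec hex
    have hm : ∀ m < Nat.find hex, D^[m] a ≠ 0 := fun m hm => Nat.find_min hex hm
    generalize Nat.find hex = n at h0 hm
    match n with
    | 0 => simp only [Function.iterate_zero, id] at h0; simp [h0] at ha
    | 1 => simp at h0; exact absurd h0 ha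
    | n+2 =>
      refine ⟨D^[n] a, ?_, ?_⟩
      · rw [← Function.iterate_succ_apply' D]; exact hm _ (by omega)
      · rw [← Function.iterate_succ_apply' D, ← Function.iterate_succ_apply' D]; exact h0
  have htr : Transcendental K a := transc_of_deriv hinj D' a ha
  have : FaithfulSMul K R := (faithfulSMul_iff_algebraMap_injective K R).mpr hinj
  have : Algebra.Transcendental K R := ⟨a, htr⟩
  have halg : Algebra.IsAlgebraic k K := by
    rw [← trdeg_eq_zero_iff]
    have h1 : Algebra.trdeg k K + Algebra.trdeg K R ≤ Algebra.trdeg k R := trdeg_add_le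
    have h2 := trdeg_le_one hfg hdim
    have h3 : 1 ≤ Algebra.trdeg K R := Cardinal.one_le_iff_pos.mpr (trdeg_pos K R)
    have h4 : Algebra.trdeg k K + 1 ≤ 0 + 1 := by
      rw [zero_add]; exact ((add_le_add_right h3 _).trans h1).trans h2
    have := (Cardinal.add_le_add_iff_of_lt_aleph0 (Cardinal.one_lt_aleph0)).1 h4
    simpa using this
  have hfield : IsField K := isField_of_isIntegral_of_isField' (Field.toIsField k)
  refine ⟨K, hfield, ?_, ?_⟩
  · let := hfield.toField
    exact finite_of_algHom_finiteType_of_isJacobsonRing (A := R) K.val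
  · obtain ⟨u, hu⟩ := hfield.mul_inv_cancel (a := (⟨D a, ha2⟩ : K)) (by
      intro h; exact ha (congrArg Subtype.val h))
    let t : R := u * a
    have ht : D' t = 1 := by
      have h1 : D a * (u : R) = 1 := congrArg Subtype.val hu
      have h2 : D (u : R) = 0 := u.2
      rw [hD']; simp [t, h2]; linear_combination h1
    have htt : Transcendental K t := transc_of_deriv hinj D' t (by rw [ht]; exact one_ne_zero)
    have hsurj : ∀ n, ∀ f : R, D^[n] f = 0 → ∃ P : K[X], aeval t P = f := by
      intro n
      induction n with
      | zero => intro f hf; exact ⟨0, by simpa using hf.symm⟩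
      | succ n ih =>
        intro f hf
        obtain ⟨P, hP⟩ := ih (D f) hf
        obtain ⟨Q, hQ⟩ := exists_antideriv (k := k) P
        have h1 : D' (f - aeval t Q) = 0 := by
          rw [map_sub, D'.map_aeval, hQ, ht, hP, hD']; simp
        refine ⟨Q + C ⟨f - aeval t Q, h1⟩, ?_⟩
        rw [map_add, aeval_C]
        change _ + (f - aeval t Q) = f
        ring
    exact ⟨(AlgEquiv.ofBijective ((aeval t : K[X] →ₐ[K] R).restrictScalars k)
      ⟨transcendental_iff_injective.mp htt, fun f => by
        obtain ⟨n, hn⟩ := hD f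
        exact hsurj n f hn⟩).symm⟩

lemma leib_iter {A : Type*} [CommRing A] (G : A →+ A)
    (hG : ∀ a b, G (a * b) = G a * b + a * G b) :
    ∀ N m n : ℕ, m + n = N → ∀ f g : A, G^[m+1] f = 0 → G^[n+1] g = 0 →
      ∃ M : ℕ, 0 < M ∧ G^[m+n] (f * g) = M * (G^[m] f * G^[n] g) := by
  intro N
  induction N with
  | zero =>
    intro m n h f g _ _
    obtain rfl : m = 0 := by omega
    obtain rfl : n = 0 := by omega
    exact ⟨1, one_pos, by simp⟩
  | succ N ih =>
    intro m n h f g hf hg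
    have key : G^[m+n] (f * g) = G^[N] (G f * g) + G^[N] (f * G g) := by
      rw [h, Function.iterate_succ_apply, hG, iterate_map_add]
    rw [key]
    rcases m with _ | m
    · obtain rfl : n = N + 1 := by omega
      obtain ⟨M, hM, h1⟩ := ih 0 N (by omega) f (G g) hf hg
      have hf' : G f = 0 := hf
      refine ⟨M, hM, ?_⟩
      rw [hf', zero_mul, iterate_map_zero, zero_add]
      simpa using h1
    · rcases n with _ | n
      · obtain rfl : m = N := by omega
        obtain ⟨M, hM, h1⟩ := ih m 0 (by omega) (G f) g hf hg
        have hg' : G g = 0 := hg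
        refine ⟨M, hM, ?_⟩
        rw [hg', mul_zero, iterate_map_zero, add_zero]
        simpa using h1
      · obtain ⟨M, hM, h1⟩ := ih m (n+1) (by omega) (G f) g hf hg
        obtain ⟨M', hM', h2⟩ := ih (m+1) n (by omega) f (G g) hf hg
        refine ⟨M + M', by omega, ?_⟩
        have e1 : m + (n+1) = N := by omega
        have e2 : m + 1 + n = N := by omega
        rw [e1] at h1
        rw [e2] at h2
        rw [h1, h2, ← Function.iterate_succ_apply, ← Function.iterate_succ_apply]
        push_cast
        ring

lemma exists_last {A : Type*} [CommRing A] (G : A →+ A) (f : A) (hf : f ≠ 0)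
    (h : ∃ n, G^[n] f = 0) : ∃ n, G^[n] f ≠ 0 ∧ G^[n+1] f = 0 := by
  classical
  have h0 := Nat.find_spec h
  have hm : ∀ m < Nat.find h, G^[m] f ≠ 0 := fun m hm => Nat.find_min h hm
  generalize Nat.find h = n at h0 hm
  match n with
  | 0 => exact absurd h0 hf
  | n+1 => exact ⟨n, hm n (by omega), h0⟩

lemma dvd_lnd {A : Type*} [CommRing A] [IsDomain A] [CharZero A] (G : A →+ A)
    (hG : ∀ a b, G (a * b) = G a * b + a * G b) (f g : A) (hf0 : f ≠ 0) (hfg : G f = f * g)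
    (hf : ∃ n, G^[n] f = 0) (hg : ∃ n, G^[n] g = 0) : g = 0 := by
  by_contra hg0
  obtain ⟨m, hm, hm'⟩ := exists_last G f hf0 hf
  obtain ⟨n, hn, hn'⟩ := exists_last G g hg0 hg
  obtain ⟨M, hM, h⟩ := leib_iter G hG _ m n rfl f g hm' hn'
  have h2 : G^[m+n] (f * g) = 0 := by
    rw [← hfg, ← Function.iterate_succ_apply, show (m+n).succ = n + (m+1) by omega,
      Function.iterate_add_apply, hm', iterate_map_zero]
  rw [h2] at h
  have hM' : (M : A) ≠ 0 := by exact_mod_cast hM.ne'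
  exact mul_ne_zero hM' (mul_ne_zero hm hn) h.symm

/-- `t` has order at most `m` and `a` is its coefficient in order `m`. -/
def PSym {k R T : Type*} [Field k] [CommRing R] [Algebra k R] [Ring T] [Algebra k T]
    (c : T ≃ₗ[k] R[X]) (m : ℕ) (a : R) (t : T) : Prop :=
  (∀ i, m < i → (c t).coeff i = 0) ∧ (c t).coeff m = a

section
variable {k R T : Type*} [Field k] [CommRing R] [Algebra k R] [Ring T] [Algebra k T]
  {c : T ≃ₗ[k] R[X]}

lemma PSym.add {m : ℕ} {a b : R} {t u : T} (h : PSym c m a t) (h' : PSym c m b u) :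
    PSym c m (a + b) (t + u) := by
  refine ⟨fun i hi => ?_, ?_⟩
  · rw [map_add, coeff_add, h.1 i hi, h'.1 i hi, add_zero]
  · rw [map_add, coeff_add, h.2, h'.2]

lemma PSym.zero (m : ℕ) : PSym c m 0 (0 : T) := by
  constructor <;> simp

lemma PSym.sum {m : ℕ} {ι : Type*} (s : Finset ι) {a : ι → R} {t : ι → T}
    (h : ∀ i ∈ s, PSym c m (a i) (t i)) : PSym c m (∑ i ∈ s, a i) (∑ i ∈ s, t i) := by
  classical
  induction s using Finset.induction_on with
  | empty => simpa using PSym.zero m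
  | insert i s hi ih =>
    rw [Finset.sum_insert hi, Finset.sum_insert hi]
    exact (h i (by simp)).add (ih fun j hj => h j (by simp [hj]))

lemma PSym.mono {m n : ℕ} {a : R} {t : T} (h : PSym c m a t) (hn : m < n) : PSym c n 0 t :=
  ⟨fun i hi => h.1 i (by omega), h.1 n hn⟩

lemma PSym.of_zero {m : ℕ} {a : R} (h : PSym c m a 0) : a = 0 := by
  have := h.2
  simpa using this.symm

variable {ι : R →ₐ[k] T} {x : T}

lemma PSym.mon (hc : ∀ n r, c (ι r * x ^ n) = monomial n r) (n : ℕ) (r : R) :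
    PSym c n r (ι r * x ^ n) := by
  refine ⟨fun i hi => ?_, ?_⟩
  · rw [hc, coeff_monomial, if_neg (by omega)]
  · rw [hc, coeff_monomial, if_pos rfl]

lemma PSym.lin (hc : ∀ n r, c (ι r * x ^ n) = monomial n r) (F : T →ₗ[k] T) (N : ℕ)
    (φ : ℕ → R → R) (hF : ∀ i r, PSym c (i + N) (φ i r) (F (ι r * x ^ i)))
    {m : ℕ} {a : R} {t : T} (h : PSym c m a t) : PSym c (m + N) (φ m a) (F t) := by
  have ht : t = ∑ i ∈ Finset.range (m + 1), ι ((c t).coeff i) * x ^ i := by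
    apply c.injective
    rw [map_sum]
    simp only [hc]
    refine as_sum_range' _ _ (Nat.lt_succ_of_le ?_)
    exact natDegree_le_iff_coeff_eq_zero.mpr fun i hi => h.1 i hi
  rw [ht, map_sum, Finset.sum_range_succ, h.2]
  have := (PSym.sum (c := c) (m := m + N) (Finset.range m) (a := fun _ => 0)
    (t := fun i => F (ι ((c t).coeff i) * x ^ i))
    (fun i hi => (hF i _).mono (by simp at hi; omega))).add (hF m a)
  simpa using this

variable {δ : Derivation k R R}

lemma PSym.x_mul (hc : ∀ n r, c (ι r * x ^ n) = monomial n r)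
    (hcomm : ∀ r : R, x * ι r = ι r * x + ι (δ r)) {m : ℕ} {a : R} {t : T}
    (h : PSym c m a t) : PSym c (m + 1) a (x * t) := by
  refine PSym.lin hc (LinearMap.mulLeft k x) 1 (fun _ r => r) (fun i r => ?_) h
  have : x * (ι r * x ^ i) = ι r * x ^ (i+1) + ι (δ r) * x ^ i := by
    rw [← mul_assoc, hcomm, pow_succ']; noncomm_ring
  rw [LinearMap.mulLeft_apply, this]
  simpa using (PSym.mon hc (i+1) r).add ((PSym.mon hc i (δ r)).mono (Nat.lt_succ_self i))

lemma PSym.iota_mul (hc : ∀ n r, c (ι r * x ^ n) = monomial n r) (s : R) {m : ℕ} {a : R} {t : T}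
    (h : PSym c m a t) : PSym c m (s * a) (ι s * t) := by
  refine PSym.lin hc (LinearMap.mulLeft k (ι s)) 0 (fun _ r => s * r) (fun i r => ?_) h
  rw [LinearMap.mulLeft_apply, ← mul_assoc, ← map_mul]
  exact PSym.mon hc i _

lemma PSym.mul (hc : ∀ n r, c (ι r * x ^ n) = monomial n r)
    (hcomm : ∀ r : R, x * ι r = ι r * x + ι (δ r)) {m n : ℕ} {a b : R} {t u : T}
    (h : PSym c m a t) (h' : PSym c n b u) : PSym c (m + n) (a * b) (t * u) := by
  refine PSym.lin hc (LinearMap.mulRight k u) n (fun _ r => r * b) (fun i r => ?_) h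
  rw [LinearMap.mulRight_apply, mul_assoc]
  apply PSym.iota_mul hc
  induction i with
  | zero => simpa using h'
  | succ i ih =>
    rw [pow_succ', mul_assoc, show i + 1 + n = i + n + 1 by ring]
    exact PSym.x_mul hc hcomm ih

lemma PSym.deriv (hc : ∀ n r, c (ι r * x ^ n) = monomial n r)
    (hcomm : ∀ r : R, x * ι r = ι r * x + ι (δ r)) (μ : T →ₗ[k] T)
    (hμ : ∀ a b : T, μ (a * b) = μ a * b + a * μ b) (d : ℕ) (D : R → R) (e : R)
    (hD : ∀ r, PSym c d (D r) (μ (ι r))) (he : PSym c (d + 1) e (μ x))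
    {m : ℕ} {a : R} {t : T} (h : PSym c m a t) : PSym c (m + d) (D a + m * e * a) (μ t) := by
  refine PSym.lin hc μ d (fun i r => D r + i * e * r) (fun i r => ?_) h
  have hx : ∀ i, PSym c i 1 (x ^ i) := fun i => by simpa using PSym.mon hc i 1
  have hi : ∀ r, PSym c 0 r (ι r) := fun r => by simpa using PSym.mon hc 0 r
  have h1 : μ 1 = 0 := by simpa using hμ 1 1
  have hpow : PSym c (i + d) (i * e) (μ (x ^ i)) := by
    induction i with
    | zero => simpa [h1] using PSym.zero (c := c) d
    | succ i ih =>
      rw [pow_succ, hμ]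
      have A := (ih.mul hc hcomm (hx 1))
      have B := ((hx i).mul hc hcomm he)
      rw [show i + d + 1 = i + 1 + d by ring, pow_one] at A
      rw [show i + (d + 1) = i + 1 + d by ring] at B
      convert A.add B using 1
      push_cast; ring
  rw [hμ]
  have A := (hD r).mul hc hcomm (hx i)
  have B := (hi r).mul hc hcomm hpow
  rw [show d + i = i + d by ring] at A
  rw [show 0 + (i + d) = i + d by ring] at B
  convert A.add B using 1
  ring

/-- The symbol derivation. -/
noncomputable def symG (D : Derivation k R R) (d : ℕ) (e : R) : R[X] →ₗ[k] R[X] :=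
  lsum fun n => ((monomial (n + d) : R →ₗ[R] R[X]).restrictScalars k).comp
    ((D : R →ₗ[k] R) + LinearMap.mulLeft k (n * e))

lemma symG_monomial (D : Derivation k R R) (d : ℕ) (e : R) (n : ℕ) (a : R) :
    symG D d e (monomial n a) = monomial (n + d) (D a + n * e * a) := by
  simp [symG, lsum_apply, sum_monomial_index, mul_assoc]

lemma symG_leib (D : Derivation k R R) (d : ℕ) (e : R) (p q : R[X]) :
    symG D d e (p * q) = symG D d e p * q + p * symG D d e q := by
  induction p using Polynomial.induction_on' with
  | add p p' h h' => simp only [add_mul, map_add, h, h']; ring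
  | monomial n a =>
    induction q using Polynomial.induction_on' with
    | add p p' h h' => simp only [mul_add, map_add, h, h']; ring
    | monomial m b =>
      simp only [monomial_mul_monomial, symG_monomial]
      rw [show n + d + m = n + m + d by ring, show n + (m + d) = n + m + d by ring, ← map_add]
      congr 1
      simp only [Derivation.leibniz, smul_eq_mul]
      push_cast; ring

lemma bounded (hc : ∀ n r, c (ι r * x ^ n) = monomial n r)
    (hcomm : ∀ r : R, x * ι r = ι r * x + ι (δ r)) (hfg : Algebra.FiniteType k R) (μ : T →ₗ[k] T)
    (hμ : ∀ a b : T, μ (a * b) = μ a * b + a * μ b) :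
    ∃ N, ∀ r i, N < i → (c (μ (ι r))).coeff i = 0 := by
  obtain ⟨s, hs⟩ := hfg.out
  refine ⟨s.sup fun r => (c (μ (ι r))).natDegree, fun r => ?_⟩
  have h1 : μ 1 = 0 := by simpa using hμ 1 1
  have hi : ∀ r, PSym c 0 r (ι r) := fun r => by simpa using PSym.mon hc 0 r
  have hr : r ∈ Algebra.adjoin k (s : Set R) := by rw [hs]; trivial
  induction hr using Algebra.adjoin_induction with
  | mem r hr =>
    intro i h
    exact coeff_eq_zero_of_natDegree_lt
      (lt_of_le_of_lt (Finset.le_sup (f := fun r => (c (μ (ι r))).natDegree) hr) h)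
  | algebraMap a =>
    intro i _
    rw [AlgHom.commutes, Algebra.algebraMap_eq_smul_one, map_smul, h1]; simp
  | add a b _ _ ha hb =>
    intro i h
    simp [ha i h, hb i h]
  | mul a b _ _ ha hb =>
    intro i h
    rw [map_mul, hμ]
    have A := (show PSym c _ _ (μ (ι a)) from ⟨ha, rfl⟩).mul hc hcomm (hi b)
    have B := (hi a).mul hc hcomm (show PSym c _ _ (μ (ι b)) from ⟨hb, rfl⟩)
    rw [zero_add] at B
    rw [add_zero] at A
    exact (A.add B).1 i h

lemma main_dir [IsDomain R] [CharZero k] (hc : ∀ n r, c (ι r * x ^ n) = monomial n r)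
    (hcomm : ∀ r : R, x * ι r = ι r * x + ι (δ r)) (hfg : Algebra.FiniteType k R) (μ : T →ₗ[k] T)
    (hμ : ∀ a b : T, μ (a * b) = μ a * b + a * μ b)
    (hnil : ∀ a : T, ∃ n : ℕ, (μ ^ n) a = 0) (hne : ∃ r, μ (ι r) ≠ 0) :
    ∃ D : Derivation k R R, (∀ a, ∃ n, D^[n] a = 0) ∧ ∃ a, D a ≠ 0 := by
  classical
  have hR0 : CharZero R := charZero_of_injective_algebraMap (algebraMap k R).injective
  have hex : ∃ d, (∀ r i, d < i → (c (μ (ι r))).coeff i = 0) ∧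
      ∀ i, d + 1 < i → (c (μ x)).coeff i = 0 := by
    obtain ⟨N, hN⟩ := bounded hc hcomm hfg μ hμ
    refine ⟨N + (c (μ x)).natDegree, fun r i h => hN r i (by omega), fun i h =>
      coeff_eq_zero_of_natDegree_lt (by omega)⟩
  obtain ⟨hd1, hd2⟩ := Nat.find_spec hex
  have hmin : ∀ m < Nat.find hex, _ := fun m hm => Nat.find_min hex hm
  generalize Nat.find hex = d at hd1 hd2 hmin
  have hi : ∀ r, PSym c 0 r (ι r) := fun r => by simpa using PSym.mon hc 0 r
  let D : Derivation k R R := Derivation.mk'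
    { toFun := fun r => (c (μ (ι r))).coeff d
      map_add' := by simp
      map_smul' := by simp } (by
      intro a b
      have A := (show PSym c _ _ (μ (ι a)) from ⟨hd1 a, rfl⟩).mul hc hcomm (hi b)
      have B := (hi a).mul hc hcomm (show PSym c _ _ (μ (ι b)) from ⟨hd1 b, rfl⟩)
      rw [zero_add] at B
      rw [add_zero] at A
      have := (A.add B).2
      rw [← hμ, ← map_mul] at this
      simp only [LinearMap.coe_mk, AddHom.coe_mk, smul_eq_mul]
      rw [this]; ring)
  have hD : ∀ r, PSym c d (D r) (μ (ι r)) := fun r => ⟨hd1 r, rfl⟩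
  set e := (c (μ x)).coeff (d + 1) with he_def
  have he : PSym c (d + 1) e (μ x) := ⟨hd2, rfl⟩
  have hstep : ∀ j, ∀ m a t, PSym c m a t → ∃ m' a', PSym c m' a' ((μ ^ j) t) ∧
      (symG D d e)^[j] (monomial m a) = monomial m' a' := by
    intro j
    induction j with
    | zero => intro m a t h; exact ⟨m, a, h, rfl⟩
    | succ j ih =>
      intro m a t h
      obtain ⟨m', a', h1, h2⟩ := ih _ _ _ (PSym.deriv hc hcomm μ hμ d D e hD he h)
      refine ⟨m', a', ?_, ?_⟩
      · rw [pow_succ]; exact h1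
      · rw [Function.iterate_succ_apply, symG_monomial]; exact h2
  have hmono : ∀ m a, ∃ j, (symG D d e)^[j] (monomial m a) = 0 := by
    intro m a
    obtain ⟨j, hj⟩ := hnil (ι a * x ^ m)
    obtain ⟨m', a', h1, h2⟩ := hstep j m a _ (PSym.mon hc m a)
    rw [hj] at h1
    exact ⟨j, by rw [h2, h1.of_zero, map_zero]⟩
  have he0 : e = 0 := by
    have := dvd_lnd (symG D d e : R[X] →ₗ[k] R[X]).toAddMonoidHom (symG_leib D d e)
      (monomial 1 1) (monomial d e) (by simp)
      (by
        change symG D d e _ = _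
        rw [symG_monomial, monomial_mul_monomial]; simp) (hmono 1 1) (hmono d e)
    simpa using this
  refine ⟨D, fun a => ?_, ?_⟩
  · obtain ⟨j, hj⟩ := hmono 0 a
    have : ∀ j m a, (symG D d e)^[j] (monomial m a) = monomial (m + j * d) (D^[j] a) := by
      intro j
      induction j with
      | zero => intro m a; simp
      | succ j ih =>
        intro m a
        rw [Function.iterate_succ_apply, symG_monomial, ih, Function.iterate_succ_apply, he0]
        simp only [mul_zero, zero_mul, add_zero]
        congr 1
        ring
    rw [this] at hj
    exact ⟨j, by simpa using hj⟩
  · by_contra hD0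
    push Not at hD0
    rcases d with _ | d
    · obtain ⟨r, hr⟩ := hne
      apply hr
      apply c.injective
      ext i
      rw [map_zero, coeff_zero]
      rcases i with _ | i
      · exact hD0 r
      · exact hd1 r _ (by omega)
    · refine hmin d (by omega) ⟨fun r i h => ?_, fun i h => ?_⟩
      · rcases eq_or_ne i (d+1) with rfl | h'
        · exact hD0 r
        · exact hd1 r i (by omega)
      · rcases eq_or_ne i (d+1+1) with rfl | h'
        · exact he0
        · exact hd2 i (by omega)

/-- The derivation d/dx. -/
noncomputable def ddx (c : T ≃ₗ[k] R[X]) : T →ₗ[k] T :=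
  (c.symm : R[X] →ₗ[k] T) ∘ₗ ((derivative : R[X] →ₗ[R] R[X]).restrictScalars k) ∘ₗ
    (c : T →ₗ[k] R[X])

lemma c_ddx (t : T) : c (ddx c t) = derivative (c t) := by
  simp [ddx]

lemma ind_mon (hc : ∀ n r, c (ι r * x ^ n) = monomial n r) (P : T → Prop)
    (hadd : ∀ a b, P a → P b → P (a + b)) (hm : ∀ n r, P (ι r * x ^ n)) (t : T) : P t := by
  rw [← c.symm_apply_apply t]
  generalize c t = p
  induction p using Polynomial.induction_on' with
  | add p q hp hq => rw [map_add]; exact hadd _ _ hp hq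
  | monomial n r => rw [← hc, c.symm_apply_apply]; exact hm n r

lemma ddx_mon (hc : ∀ n r, c (ι r * x ^ n) = monomial n r) (n : ℕ) (r : R) :
    ddx c (ι r * x ^ n) = ι (r * n) * x ^ (n - 1) := by
  apply c.injective
  rw [c_ddx, hc, hc, derivative_monomial]

lemma ddx_leib (hc : ∀ n r, c (ι r * x ^ n) = monomial n r)
    (hcomm : ∀ r : R, x * ι r = ι r * x + ι (δ r)) (a b : T) :
    ddx c (a * b) = ddx c a * b + a * ddx c b := by
  have hι : ∀ (r : R) (b : T), ddx c (ι r * b) = ι r * ddx c b := by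
    intro r b
    induction b using ind_mon hc with
    | hadd a b ha hb => simp only [mul_add, map_add, ha, hb]
    | hm n s => rw [← mul_assoc, ← map_mul, ddx_mon hc, ddx_mon hc, ← mul_assoc, ← map_mul,
        mul_assoc]
  have hx : ∀ b : T, ddx c (x * b) = b + x * ddx c b := by
    intro b
    induction b using ind_mon hc with
    | hadd a b ha hb => simp only [mul_add, map_add, ha, hb]; abel
    | hm n s =>
      have e : x * (ι s * x ^ n) = ι s * x ^ (n+1) + ι (δ s) * x ^ n := by
        rw [← mul_assoc, hcomm, pow_succ']; noncomm_ring
      rw [e, map_add, ddx_mon hc, ddx_mon hc, ddx_mon hc, ← mul_assoc x, hcomm]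
      rcases n with _ | n
      · simp
      · simp only [Nat.add_sub_cancel, Derivation.leibniz, Derivation.map_natCast, add_mul,
          mul_assoc, ← pow_succ']
        push_cast
        simp only [smul_eq_mul, mul_zero, zero_add, mul_add, add_mul, mul_one, map_add, map_mul,
          map_natCast, map_one]
        have e1 := Nat.cast_commute n (ι (δ s))
        rw [e1.eq, one_mul]
        abel
  have hxn : ∀ (n : ℕ) (b : T), ddx c (x ^ n * b) = ddx c (x ^ n) * b + x ^ n * ddx c b := by
    intro n
    induction n with
    | zero =>
      intro b
      have : ddx c (1 : T) = 0 := by simpa using ddx_mon hc 0 1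
      simp [this]
    | succ n ih =>
      intro b
      rw [pow_succ', mul_assoc, hx, ih, hx]
      noncomm_ring
  induction a using ind_mon hc with
  | hadd a a' ha ha' => simp only [add_mul, map_add, ha, ha']; abel
  | hm n r => rw [mul_assoc, hι, hxn, hι]; noncomm_ring

end

end

open Polynomial in
/-- Let `R` be an affine commutative domain of Krull dimension one over a
field `k` of characteristic zero, `δ` a `k`-derivation of `R`, and
`T = R[x; δ]` a skew polynomial ring of derivation type. Then either
`R ≅ k'[t]` with `k'` a finite field extension of `k` inside `R`, or
`ML(T) = ι(R)`. -/
theorem stmt_12 (k R T : Type*) [Field k] [CharZero k]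
    [CommRing R] [IsDomain R] [Algebra k R] [Ring T] [Algebra k T]
    (hfg : Algebra.FiniteType k R) (hdim : ringKrullDim R = 1)
    (δ : Derivation k R R)
    (ι : R →ₐ[k] T) (hι : Function.Injective ι) (x : T)
    (hrep : ∀ t : T, ∃! b : ℕ →₀ R, t = b.sum fun i r => ι r * x ^ i)
    (hcomm : ∀ r : R, x * ι r = ι r * x + ι (δ r)) :
    (∃ k' : Subalgebra k R, IsField k' ∧ FiniteDimensional k k' ∧
        Nonempty (R ≃ₐ[k] Polynomial k')) ∨
    ({t : T | ∀ μ : T →ₗ[k] T, (∀ a b : T, μ (a * b) = μ a * b + a * μ b) →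
        (∀ a : T, ∃ n : ℕ, (μ ^ n) a = 0) → μ t = 0} = Set.range ι) := by
  classical
  let E : R[X] →ₗ[k] T := lsum fun n => (LinearMap.mulRight k (x ^ n)).comp ι.toLinearMap
  have hE : ∀ p : R[X], E p = p.sum fun i r => ι r * x ^ i := fun p => by
    simp [E, lsum_apply]
  have hEf : ∀ p : R[X], (p.sum fun i r => ι r * x ^ i)
      = (p.toFinsupp).coeff.sum fun i r => ι r * x ^ i := fun p => rfl
  have hbij : Function.Bijective E := by
    refine ⟨fun p q hpq => ?_, fun t => ?_⟩
    · rw [hE, hE, hEf, hEf] at hpq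
      obtain ⟨b, -, hb⟩ := hrep (q.toFinsupp.coeff.sum fun i r => ι r * x ^ i)
      have h1 := hb p.toFinsupp.coeff hpq.symm
      have h2 := hb q.toFinsupp.coeff rfl
      exact toFinsupp_injective (AddMonoidAlgebra.coeff_injective (h1.trans h2.symm))
    · obtain ⟨b, hb, -⟩ := hrep t
      exact ⟨⟨.ofCoeff b⟩, by rw [hE, hEf]; exact hb.symm⟩
  let c : T ≃ₗ[k] R[X] := (LinearEquiv.ofBijective E hbij).symm
  have hc : ∀ n r, c (ι r * x ^ n) = monomial n r := by
    intro n r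
    rw [LinearEquiv.symm_apply_eq, LinearEquiv.ofBijective_apply, hE, sum_monomial_index]
    simp
  by_cases hi : (∃ k' : Subalgebra k R, IsField k' ∧ FiniteDimensional k k' ∧
        Nonempty (R ≃ₐ[k] Polynomial k'))
  · exact Or.inl hi
  · right
    ext t
    simp only [Set.mem_ofPred_eq, Set.mem_range]
    have hR0 : CharZero R := charZero_of_injective_algebraMap (algebraMap k R).injective
    constructor
    · intro h
      have h0 := h (ddx c) (ddx_leib hc hcomm) (fun a => by
        refine ⟨(c a).natDegree + 1, c.injective ?_⟩
        have : ∀ n a, c ((ddx c ^ n) a) = derivative^[n] (c a) := by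
          intro n
          induction n with
          | zero => intro a; rfl
          | succ n ih =>
            intro a
            rw [pow_succ, Module.End.mul_apply, ih, c_ddx, Function.iterate_succ_apply]
        rw [this, map_zero]
        exact iterate_derivative_eq_zero (Nat.lt_succ_self _))
      have h1 : derivative (c t) = 0 := by rw [← c_ddx, h0, map_zero]
      obtain ⟨r, hr⟩ := natDegree_eq_zero.mp (derivative_eq_zero.mp h1)
      refine ⟨r, c.injective ?_⟩
      rw [← hr, ← monomial_zero_left, ← hc]
      simp
    · rintro ⟨r, rfl⟩ μ hμ hnil
      by_contra hr
      obtain ⟨D, hD, hD'⟩ := main_dir hc hcomm hfg μ hμ hnil ⟨r, hr⟩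
      exact hi (lnd_case hfg hdim D hD hD')
end

section
/- Let k be a field of characteristic zero and let A be a finitely generated k-algebra that is a domain in which the nonzero elements satisfy the left and right Ore conditions (for all nonzero a, b ∈ A there exist x, y ∈ A with a·x = b·y ≠ 0, and there exist u, v ∈ A with u·a = v·b ≠ 0). Let δ be a k-linear derivation of A and let T be a skew polynomial ring A[x;δ]: a k-algebra with an injective k-algebra homomorphism ι : A → T and an element x ∈ T such that every element of T is uniquely a finite sum Σ_i ι(a_i)x^i and x·ι(a) = ι(a)·x + ι(δ(a)) for all a ∈ A. If ML(A) = A, i.e., every locally nilpotent k-linear derivation of A is zero, then ML(T) = ML(A): the set of elements of T annihilated by every locally nilpotent k-linear derivation of T is exactly ι(A). -/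
/-- Coefficient data for a skew polynomial ring. -/
structure SkewData {k A T : Type*} [Field k] [Ring A] [Algebra k A] [Ring T] [Algebra k T]
    (δ : A →ₗ[k] A) (ι : A →ₐ[k] T) (x : T) where
  cf : ℕ → T →ₗ[k] A
  fin : ∀ t, ∃ n, ∀ i, n ≤ i → cf i t = 0
  inj : ∀ t, (∀ i, cf i t = 0) → t = 0
  mon : ∀ n j a, cf n (ι a * x ^ j) = if n = j then a else 0
  cf_x0 : ∀ t, cf 0 (x * t) = δ (cf 0 t)
  cf_x : ∀ n t, cf (n+1) (x * t) = cf n t + δ (cf (n+1) t)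
  cf_i : ∀ n a t, cf n (ι a * t) = a * cf n t
  D : T →ₗ[k] T
  cf_D : ∀ n t, cf n (D t) = ((n+1 : ℕ) : A) * cf (n+1) t

namespace SkewData

variable {k A T : Type*} [Field k] [Ring A] [Algebra k A] [Ring T] [Algebra k T]
    {δ : A →ₗ[k] A} {ι : A →ₐ[k] T} {x : T}

theorem exists_data
    (ι : A →ₐ[k] T) (x : T)
    (hrep : ∀ t : T, ∃! b : ℕ →₀ A, t = b.sum fun i r => ι r * x ^ i)
    (hcomm : ∀ r : A, x * ι r = ι r * x + ι (δ r)) : Nonempty (SkewData δ ι x) := by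
  classical
  let Φ : (ℕ →₀ A) →ₗ[k] T :=
    Finsupp.lsum k (fun i => (LinearMap.mulRight k (x ^ i)).comp ι.toLinearMap)
  have hΦ : ∀ b, Φ b = b.sum fun i r => ι r * x ^ i := by
    intro b
    simp only [Φ, Finsupp.lsum_apply]
    rfl
  have hbij : Function.Bijective Φ := by
    constructor
    · intro a b hab
      obtain ⟨c, -, hc⟩ := hrep (Φ a)
      rw [hc a (hΦ a), hc b (hab.trans (hΦ b))]
    · intro t
      obtain ⟨c, hc, -⟩ := hrep t
      exact ⟨c, by rw [hΦ]; exact hc.symm⟩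
  let E := LinearEquiv.ofBijective Φ hbij
  have hEs : ∀ j a, E (Finsupp.single j a) = ι a * x ^ j := by
    intro j a
    change Φ _ = _
    rw [hΦ]; simp
  have hmon' : ∀ j a, E.symm (ι a * x ^ j) = Finsupp.single j a := by
    intro j a
    rw [← hEs, E.symm_apply_apply]
  let cf : ℕ → T →ₗ[k] A := fun n => (Finsupp.lapply n).comp E.symm.toLinearMap
  have hcf : ∀ n t, cf n t = E.symm t n := fun n t => rfl
  have hmon : ∀ n j a, cf n (ι a * x ^ j) = if n = j then a else 0 := by
    intro n j a
    rw [hcf, hmon', Finsupp.single_apply]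
    simp [eq_comm]
  have hind : ∀ (P : T → Prop), (∀ j a, P (ι a * x ^ j)) → (∀ s t, P s → P t → P (s + t)) →
      ∀ t, P t := by
    intro P h1 h2 t
    have : ∀ b, P (E b) := by
      intro b
      induction b using Finsupp.induction_linear with
      | zero => simpa using h1 0 0
      | add f g hf hg => rw [map_add]; exact h2 _ _ hf hg
      | single j a => rw [hEs]; exact h1 j a
    simpa using this (E.symm t)
  have hxm : ∀ j a, x * (ι a * x ^ j) = ι a * x ^ (j+1) + ι (δ a) * x ^ j := by
    intro j a
    rw [← mul_assoc, hcomm, add_mul, mul_assoc, pow_succ' x j]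
  let D0 : (ℕ →₀ A) →ₗ[k] (ℕ →₀ A) :=
    Finsupp.lsum k (fun i => i • (Finsupp.lsingle (i-1) : A →ₗ[k] (ℕ →₀ A)))
  have hD0 : ∀ j a, D0 (Finsupp.single j a) = j • Finsupp.single (j-1) a := by
    intro j a
    simp [D0, Finsupp.lsum_apply]
  refine ⟨⟨cf, ?_, ?_, hmon, ?_, ?_, ?_, E.toLinearMap.comp (D0.comp E.symm.toLinearMap), ?_⟩⟩
  · intro t
    refine ⟨(E.symm t).support.sup id + 1, fun i hi => ?_⟩
    by_contra h
    have : i ≤ (E.symm t).support.sup id :=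
      Finset.le_sup (f := id) (Finsupp.mem_support_iff.mpr h)
    omega
  · intro t h
    have : E.symm t = 0 := Finsupp.ext h
    simpa using this
  · apply hind
    · intro j a
      rw [hxm, map_add, hmon, hmon, hmon]
      rcases j with _ | j <;> simp
    · intro s t hs ht
      simp [mul_add, hs, ht]
  · intro n
    apply hind
    · intro j a
      rw [hxm, map_add, hmon, hmon, hmon, hmon]
      by_cases h : n = j <;> by_cases h' : n + 1 = j <;> simp [h, h']
    · intro s t hs ht
      rw [mul_add, map_add, hs, ht]; simp; abel
  · intro n a
    apply hind
    · intro j b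
      rw [← mul_assoc, ← map_mul, hmon, hmon]; simp
    · intro s t hs ht
      simp [mul_add, hs, ht]
  · intro n
    apply hind
    · intro j a
      rw [hmon, hcf]
      simp only [LinearMap.comp_apply, LinearEquiv.coe_coe, E.symm_apply_apply, hmon', hD0]
      rcases j with _ | j
      · simp
      · by_cases h : n = j
        · subst h; simp
        · simp [Finsupp.single_apply, h, Ne.symm h]
    · intro s t hs ht
      rw [map_add, map_add, hs, ht, map_add, mul_add]

variable (S : SkewData δ ι x)

def F (n : ℕ) : Submodule k T where
  carrier := {t | ∀ i, n ≤ i → S.cf i t = 0}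
  add_mem' := by
    intro a b ha hb i hi
    simp [ha i hi, hb i hi]
  zero_mem' := by intro i hi; simp
  smul_mem' := by
    intro c a ha i hi
    simp [ha i hi]

theorem F_mono {m n : ℕ} (h : m ≤ n) {t : T} (ht : t ∈ S.F m) : t ∈ S.F n :=
  fun i hi => ht i (h.trans hi)

theorem F_zero {t : T} (ht : t ∈ S.F 0) : t = 0 := S.inj t fun i => ht i (Nat.zero_le i)

theorem mon_mem (a : A) (j : ℕ) : ι a * x ^ j ∈ S.F (j+1) := by
  intro i hi
  rw [S.mon, if_neg (by omega)]

theorem pow_mem (j : ℕ) : x ^ j ∈ S.F (j+1) := by simpa using S.mon_mem 1 j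

theorem cf_pow (j : ℕ) : S.cf j (x ^ j) = 1 := by simpa using S.mon j j 1

theorem i_mem (a : A) : ι a ∈ S.F 1 := by simpa using S.mon_mem a 0

theorem cf_i0 (a : A) : S.cf 0 (ι a) = a := by simpa using S.mon 0 0 a

theorem decomp {j : ℕ} {t : T} (ht : t ∈ S.F (j+1)) :
    ∃ s ∈ S.F j, t = ι (S.cf j t) * x ^ j + s := by
  refine ⟨t - ι (S.cf j t) * x ^ j, ?_, by abel⟩
  intro i hi
  rw [map_sub, S.mon]
  rcases hi.eq_or_lt with h | h
  · subst h; simp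
  · rw [ht i h, if_neg (by omega)]; simp

theorem eq_i {t : T} (ht : t ∈ S.F 1) : t = ι (S.cf 0 t) := by
  obtain ⟨s, hs, h⟩ := S.decomp (j := 0) ht
  rw [S.F_zero hs] at h
  simpa using h

include S in
theorem ind (P : T → Prop) (h0 : P 0) (h1 : ∀ j a, P (ι a * x ^ j))
    (h2 : ∀ s t, P s → P t → P (s + t)) (t : T) : P t := by
  obtain ⟨n, hn⟩ := S.fin t
  have hn : t ∈ S.F n := hn
  induction n generalizing t with
  | zero => rw [S.F_zero hn]; exact h0
  | succ n ih =>
    obtain ⟨s, hs, h⟩ := S.decomp hn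
    rw [h]
    exact h2 _ _ (h1 _ _) (ih s hs hs)

theorem i_mul_mem (a : A) {n : ℕ} {t : T} (ht : t ∈ S.F n) : ι a * t ∈ S.F n := by
  intro i hi
  rw [S.cf_i, ht i hi, mul_zero]

theorem xpow_mul {j : ℕ} {t : T} (ht : t ∈ S.F (j+1)) (l : ℕ) :
    x ^ l * t ∈ S.F (l+j+1) ∧ S.cf (l+j) (x ^ l * t) = S.cf j t := by
  induction l with
  | zero => simpa using ht
  | succ l ih =>
    obtain ⟨h1, h2⟩ := ih
    rw [pow_succ', mul_assoc]
    constructor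
    · intro i hi
      obtain ⟨i, rfl⟩ : ∃ i', i = i' + 1 := ⟨i - 1, by omega⟩
      rw [S.cf_x, h1 i (by omega), h1 (i+1) (by omega)]; simp
    · rw [show l + 1 + j = l + j + 1 by omega, S.cf_x, h1 (l+j+1) le_rfl, h2]; simp

theorem mul_mem {i j : ℕ} {s t : T} (hs : s ∈ S.F i) (ht : t ∈ S.F (j+1)) :
    s * t ∈ S.F (i+j) := by
  induction i generalizing s with
  | zero => rw [S.F_zero hs, zero_mul]; exact zero_mem _
  | succ i ih =>
    obtain ⟨r, hr, h⟩ := S.decomp hs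
    rw [h, add_mul]
    refine add_mem ?_ (S.F_mono (by omega) (ih hr))
    rw [mul_assoc]
    exact S.i_mul_mem _ (S.F_mono (by omega) (S.xpow_mul ht i).1)

theorem cf_mul {i j : ℕ} {s t : T} (hs : s ∈ S.F (i+1)) (ht : t ∈ S.F (j+1)) :
    S.cf (i+j) (s * t) = S.cf i s * S.cf j t := by
  obtain ⟨r, hr, h⟩ := S.decomp hs
  have : s * t = ι (S.cf i s) * (x ^ i * t) + r * t := by
    rw [← mul_assoc, ← add_mul, ← h]
  rw [this, map_add, S.cf_i, (S.xpow_mul ht i).2, S.mul_mem hr ht _ le_rfl, add_zero]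

theorem ext' {s t : T} (h : ∀ i, S.cf i s = S.cf i t) : s = t :=
  sub_eq_zero.mp (S.inj _ fun i => by rw [map_sub, h, sub_self])

theorem D_i (a : A) (t : T) : S.D (ι a * t) = ι a * S.D t := by
  apply S.ext'
  intro n
  rw [S.cf_D, S.cf_i, S.cf_i, S.cf_D, ← mul_assoc, ← mul_assoc, Nat.cast_comm]

theorem D_x (t : T) : S.D (x * t) = t + x * S.D t := by
  apply S.ext'
  intro n
  rw [S.cf_D, S.cf_x, map_add]
  rcases n with _ | n
  · rw [S.cf_x0, S.cf_D]; simp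
  · rw [S.cf_x, S.cf_D, S.cf_D]
    simp only [← nsmul_eq_mul, map_nsmul, smul_add]
    rw [succ_nsmul (S.cf (n+1) t)]
    abel

theorem D_xpow (j : ℕ) (t : T) : S.D (x ^ j * t) = S.D (x ^ j) * t + x ^ j * S.D t := by
  induction j generalizing t with
  | zero =>
    have : S.D 1 = 0 := by
      apply S.inj; intro n
      rw [S.cf_D, show (1:T) = ι 1 by simp, S.i_mem 1 _ (by omega), mul_zero]
    simp [this]
  | succ j ih =>
    rw [pow_succ', mul_assoc, S.D_x, S.D_x, ih]
    simp only [mul_add, add_mul, mul_assoc]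
    abel

theorem D_mul (s t : T) : S.D (s * t) = S.D s * t + s * S.D t := by
  revert s
  apply S.ind
  · simp
  · intro j a
    rw [mul_assoc, S.D_i, S.D_i, S.D_xpow]
    simp only [mul_add, mul_assoc]
  · intro s r hs hr
    rw [add_mul, map_add, map_add, hs, hr]
    simp only [add_mul]
    abel

theorem D_nil (t : T) : ∃ n : ℕ, (S.D ^ n) t = 0 := by
  obtain ⟨n, hn⟩ := S.fin t
  have hn : t ∈ S.F n := hn
  refine ⟨n, ?_⟩
  induction n generalizing t with
  | zero => rw [S.F_zero hn]; simp
  | succ n ih =>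
    rw [pow_succ, Module.End.mul_apply]
    have : S.D t ∈ S.F n := by
      intro i hi
      rw [S.cf_D, hn (i+1) (by omega), mul_zero]
    exact ih _ this this

/-- iterated twisted operator -/
def It (d : A →ₗ[k] A) (c : A) (m : ℕ) : ℕ → ℕ → A → A
  | _, 0, a => a
  | j, n+1, a => It d c m (j+m) n (d a + a * (j * c))

theorem It_zero (d : A →ₗ[k] A) (c : A) (m n : ℕ) : ∀ j, It d c m j n 0 = 0 := by
  induction n with
  | zero => intro j; rfl
  | succ n ih => intro j; simp [It, ih]

theorem It_add (d : A →ₗ[k] A) (c : A) (m n : ℕ) :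
    ∀ j a b, It d c m j n (a + b) = It d c m j n a + It d c m j n b := by
  induction n with
  | zero => intro j a b; rfl
  | succ n ih =>
    intro j a b
    simp only [It, ← ih]
    congr 1
    rw [map_add, add_mul]; abel

theorem It_le (d : A →ₗ[k] A) (c : A) (m n : ℕ) : ∀ j a l, n ≤ l → It d c m j n a = 0 →
    It d c m j l a = 0 := by
  induction n with
  | zero => intro j a l _ h; simp only [It] at h; rw [h, It_zero]
  | succ n ih =>
    intro j a l hl h
    obtain ⟨l, rfl⟩ : ∃ l', l = l' + 1 := ⟨l - 1, by omega⟩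
    exact ih (j+m) _ l (by omega) h

theorem It_mul (d : A →ₗ[k] A) (hd : ∀ a b, d (a * b) = d a * b + a * d b) (c : A)
    (hc : ∀ a, c * a = a * c) (m n : ℕ) : ∀ p q i j a b, p + q = n →
    It d c m i (p+1) a = 0 → It d c m j (q+1) b = 0 →
    It d c m (i+j) n (a * b) = (n.choose p : A) * (It d c m i p a * It d c m j q b) := by
  induction n with
  | zero =>
    intro p q i j a b h _ _
    obtain ⟨rfl, rfl⟩ : p = 0 ∧ q = 0 := by omega
    simp [It]
  | succ n ih =>
    intro p q i j a b h ha hb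
    have key : It d c m (i+j) (n+1) (a*b) =
        It d c m (i+m+j) n ((d a + a * (i * c)) * b) +
        It d c m (i+(j+m)) n (a * (d b + b * (j * c))) := by
      rw [show i + m + j = i + j + m by omega, show i + (j+m) = i + j + m by omega, ← It_add]
      simp only [It]
      congr 1
      have e1 : (i * c) * b = b * (i * c) := by
        rw [mul_assoc, hc, ← mul_assoc, Nat.cast_comm, mul_assoc]
      rw [hd, add_mul, mul_assoc a (i * c : A) b, e1]
      push_cast
      simp only [mul_add, add_mul, mul_assoc]
      abel
    rw [key]
    rcases p with _ | p
    · obtain rfl : q = n + 1 := by omega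
      have ha' : d a + a * (i * c) = 0 := ha
      rw [ha', zero_mul, It_zero, ih 0 n i (j+m) a _ (by omega) ha hb]
      simp [It]
    · rw [ih p q (i+m) j _ b (by omega) ha hb]
      rcases q with _ | q
      · obtain rfl : p = n := by omega
        have hb' : d b + b * (j * c) = 0 := hb
        rw [hb', mul_zero, It_zero]
        simp [It]
      · rw [ih (p+1) q i (j+m) a _ (by omega) ha hb]
        rw [Nat.choose_succ_succ]
        push_cast
        rw [add_mul]
        rfl

theorem c_zero [IsDomain A] [CharZero A] (d : A →ₗ[k] A)
    (hd : ∀ a b, d (a * b) = d a * b + a * d b) (c : A)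
    (hc : ∀ a, c * a = a * c) (m : ℕ) (hnil : ∀ j a, ∃ n, It d c m j n a = 0) : c = 0 := by
  classical
  by_contra hc0
  have h : ∀ j a, a ≠ 0 → ∃ p, It d c m j p a ≠ 0 ∧ It d c m j (p+1) a = 0 := by
    intro j a ha
    have hp := Nat.find_spec (hnil j a)
    have hm := fun l => Nat.find_min (hnil j a) (m := l)
    generalize Nat.find (hnil j a) = p at hp hm
    rcases p with _ | p
    · exact absurd hp ha
    · exact ⟨p, hm p (by omega), hp⟩
  obtain ⟨p, hp, hp'⟩ := h 1 1 one_ne_zero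
  obtain ⟨q, hq, hq'⟩ := h m c hc0
  have e := It_mul d hd c hc m (p+q) p q 1 m 1 c rfl hp' hq'
  have hd1 : d 1 = 0 := by simpa using hd 1 1
  have e2 : It d c m 1 (p+q+1) 1 = It d c m (1+m) (p+q) (1*c) := by
    simp [It, hd1]
  rw [← e2, It_le d c m (p+1) _ _ _ (by omega) hp'] at e
  have : ((p+q).choose p : A) ≠ 0 := Nat.cast_ne_zero.mpr (Nat.choose_pos (by omega)).ne'
  exact (mul_ne_zero this (mul_ne_zero hp hq)) e.symm

section mu

variable (μ : T →ₗ[k] T) (hμ : ∀ a b : T, μ (a * b) = μ a * b + a * μ b)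
  (m : ℕ) (h1 : ∀ a, μ (ι a) ∈ S.F (m+1)) (h2 : μ x ∈ S.F (m+2))

include hμ h2 in
theorem mu_pow (j : ℕ) : μ (x ^ j) ∈ S.F (j+m+1) ∧
    S.cf (j+m) (μ (x ^ j)) = j * S.cf (m+1) (μ x) := by
  have hx : x ∈ S.F (1+1) := by simpa using S.pow_mem 1
  have hx1 : S.cf 1 x = 1 := by simpa using S.cf_pow 1
  induction j with
  | zero =>
    have : μ 1 = 0 := by simpa using hμ 1 1
    simp [this]
  | succ j ih =>
    rw [pow_succ, hμ]
    constructor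
    · refine add_mem (S.F_mono ?_ (S.mul_mem ih.1 hx)) (S.F_mono ?_ (S.mul_mem (S.pow_mem j) h2))
      all_goals omega
    · have e1 := S.cf_mul ih.1 hx
      have e2 := S.cf_mul (S.pow_mem (x := x) j) h2
      rw [map_add, show j + 1 + m = j + m + 1 by omega, e1, ih.2, hx1, mul_one,
        show j + m + 1 = j + (m+1) by omega, e2, S.cf_pow]
      push_cast
      simp [add_mul]

include hμ h1 h2 in
theorem mu_mon (j : ℕ) (a : A) : μ (ι a * x ^ j) ∈ S.F (j+m+1) ∧
    S.cf (j+m) (μ (ι a * x ^ j)) = S.cf m (μ (ι a)) + a * (j * S.cf (m+1) (μ x)) := by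
  obtain ⟨p1, p2⟩ := S.mu_pow μ hμ m h2 j
  rw [hμ]
  constructor
  · exact add_mem (S.F_mono (by omega) (S.mul_mem (h1 a) (S.pow_mem j))) (S.i_mul_mem _ p1)
  · rw [map_add, S.cf_i, p2, add_comm j m, S.cf_mul (h1 a) (S.pow_mem j), S.cf_pow, mul_one]

include hμ h1 h2 in
theorem mu_F {j : ℕ} {t : T} (ht : t ∈ S.F j) : μ t ∈ S.F (j+m) := by
  induction j generalizing t with
  | zero => rw [S.F_zero ht, map_zero]; exact zero_mem _
  | succ j ih =>
    obtain ⟨s, hs, h⟩ := S.decomp ht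
    rw [h, map_add]
    exact add_mem (S.F_mono (by omega) (S.mu_mon μ hμ m h1 h2 j _).1)
      (S.F_mono (by omega) (ih hs))

include hμ h1 h2 in
theorem mu_cf {j : ℕ} {t : T} (ht : t ∈ S.F (j+1)) : S.cf (j+m) (μ t) =
    S.cf m (μ (ι (S.cf j t))) + S.cf j t * (j * S.cf (m+1) (μ x)) := by
  obtain ⟨s, hs, h⟩ := S.decomp ht
  have : μ t = μ (ι (S.cf j t) * x ^ j) + μ s := by rw [← map_add, ← h]
  rw [this, map_add, (S.mu_mon μ hμ m h1 h2 j _).2, S.mu_F μ hμ m h1 h2 hs _ le_rfl, add_zero]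

def dd : A →ₗ[k] A := (S.cf m).comp (μ.comp ι.toLinearMap)

include hμ h1 h2 in
theorem mu_iter (n : ℕ) : ∀ (j : ℕ) (t : T), t ∈ S.F (j+1) →
    S.cf (j+n*m) ((μ ^ n) t) = It (S.dd μ m) (S.cf (m+1) (μ x)) m j n (S.cf j t) := by
  induction n with
  | zero => intro j t ht; simp [It]
  | succ n ih =>
    intro j t ht
    have hm : μ t ∈ S.F (j+m+1) := S.F_mono (by omega) (S.mu_F μ hμ m h1 h2 ht)
    have := ih (j+m) (μ t) hm
    rw [pow_succ, Module.End.mul_apply, show j + (n+1)*m = j + m + n * m by ring, this,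
      S.mu_cf μ hμ m h1 h2 ht]
    rfl

include hμ h1 h2 in
theorem step [IsDomain A] [CharZero A]
    (hcomm : ∀ r : A, x * ι r = ι r * x + ι (δ r))
    (hnil : ∀ a : T, ∃ n : ℕ, (μ ^ n) a = 0)
    (hML : ∀ μ : A →ₗ[k] A, (∀ a b : A, μ (a * b) = μ a * b + a * μ b) →
      (∀ a : A, ∃ n : ℕ, (μ ^ n) a = 0) → μ = 0) :
    (∀ a, μ (ι a) ∈ S.F m) ∧ μ x ∈ S.F (m+1) := by
  have hx : x ∈ S.F (1+1) := by simpa using S.pow_mem 1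
  have hx1 : S.cf 1 x = 1 := by simpa using S.cf_pow 1
  have hd : ∀ a b, S.dd μ m (a * b) = S.dd μ m a * b + a * S.dd μ m b := by
    intro a b
    change S.cf m (μ (ι (a * b))) = S.cf m (μ (ι a)) * b + a * S.cf m (μ (ι b))
    rw [map_mul, hμ, map_add, S.cf_i]
    have := S.cf_mul (h1 a) (S.i_mem b)
    rw [add_zero, S.cf_i0] at this
    rw [this]
  have hc : ∀ a, S.cf (m+1) (μ x) * a = a * S.cf (m+1) (μ x) := by
    intro a
    have e := congrArg (fun t => S.cf (m+1) (μ t)) (hcomm a)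
    simp only [map_add, hμ] at e
    have e1 := S.cf_mul h2 (S.i_mem a)
    have e2 := S.cf_mul hx (h1 a)
    have e3 := S.cf_mul (h1 a) hx
    rw [add_zero, S.cf_i0] at e1
    rw [add_comm 1 m, hx1, one_mul] at e2
    rw [hx1, mul_one] at e3
    rw [e1, e2, e3, S.cf_i, h1 (δ a) _ le_rfl, add_zero, add_comm] at e
    exact add_left_cancel e
  have hn : ∀ j a, ∃ n, It (S.dd μ m) (S.cf (m+1) (μ x)) m j n a = 0 := by
    intro j a
    obtain ⟨n, hn⟩ := hnil (ι a * x ^ j)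
    refine ⟨n, ?_⟩
    have := S.mu_iter μ hμ m h1 h2 n j _ (S.mon_mem a j)
    rw [hn, map_zero, S.mon, if_pos rfl] at this
    exact this.symm
  have c0 := c_zero _ hd _ hc m hn
  have hI : ∀ n j a, It (S.dd μ m) 0 m j n a = ((S.dd μ m) ^ n) a := by
    intro n
    induction n with
    | zero => intro j a; simp [It]
    | succ n ih => intro j a; simp [It, ih, pow_succ]
  have d0 := hML (S.dd μ m) hd (fun a => by
    obtain ⟨n, h⟩ := hn 0 a
    rw [c0, hI] at h
    exact ⟨n, h⟩)
  constructor
  · intro a i hi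
    rcases hi.eq_or_lt with h | h
    · subst h
      exact LinearMap.congr_fun d0 a
    · exact h1 a i h
  · intro i hi
    rcases hi.eq_or_lt with h | h
    · subst h; exact c0
    · exact h2 i h

include hμ in
theorem bound (hfg : Algebra.FiniteType k A) :
    ∃ m, (∀ a, μ (ι a) ∈ S.F m) ∧ μ x ∈ S.F (m+1) := by
  obtain ⟨s, hs⟩ := hfg.out
  choose N hN using S.fin
  have hN : ∀ t, t ∈ S.F (N t) := hN
  obtain ⟨m, hm⟩ : ∃ m, m = s.sup (fun a => N (μ (ι a))) + N (μ x) := ⟨_, rfl⟩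
  refine ⟨m, ?_, S.F_mono (by omega) (hN (μ x))⟩
  intro a
  have ha : a ∈ Algebra.adjoin k (s : Set A) := by rw [hs]; trivial
  induction ha using Algebra.adjoin_induction with
  | mem a ha =>
    refine S.F_mono ?_ (hN _)
    have := Finset.le_sup (f := fun a => N (μ (ι a))) (Finset.mem_coe.mp ha)
    omega
  | algebraMap r =>
    have h1 : μ 1 = 0 := by simpa using hμ 1 1
    rw [AlgHom.commutes, Algebra.algebraMap_eq_smul_one, map_smul, h1, smul_zero]
    exact zero_mem _
  | add a b _ _ ha hb => rw [map_add, map_add]; exact add_mem ha hb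
  | mul a b _ _ ha hb =>
    rw [map_mul, hμ]
    exact add_mem (S.mul_mem ha (S.i_mem b)) (S.i_mul_mem _ hb)

end mu

end SkewData

/-- For a finitely generated Ore domain `A` over a field `k` of characteristic
zero with `ML(A) = A`, and a skew polynomial ring `T = A[x; δ]` of derivation
type, one has `ML(T) = ι(A)`. -/
theorem stmt_13 (k A T : Type*) [Field k] [CharZero k]
    [Ring A] [IsDomain A] [Algebra k A] [Ring T] [Algebra k T]
    (hfg : Algebra.FiniteType k A)
    (hOreRight : ∀ a b : A, a ≠ 0 → b ≠ 0 →
      ∃ x y : A, a * x = b * y ∧ a * x ≠ 0)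
    (hOreLeft : ∀ a b : A, a ≠ 0 → b ≠ 0 →
      ∃ u v : A, u * a = v * b ∧ u * a ≠ 0)
    (δ : A →ₗ[k] A) (hδ : ∀ a b : A, δ (a * b) = δ a * b + a * δ b)
    (ι : A →ₐ[k] T) (hι : Function.Injective ι) (x : T)
    (hrep : ∀ t : T, ∃! b : ℕ →₀ A, t = b.sum fun i r => ι r * x ^ i)
    (hcomm : ∀ r : A, x * ι r = ι r * x + ι (δ r))
    (hML : ∀ μ : A →ₗ[k] A, (∀ a b : A, μ (a * b) = μ a * b + a * μ b) →
      (∀ a : A, ∃ n : ℕ, (μ ^ n) a = 0) → μ = 0) :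
    {t : T | ∀ μ : T →ₗ[k] T, (∀ a b : T, μ (a * b) = μ a * b + a * μ b) →
      (∀ a : T, ∃ n : ℕ, (μ ^ n) a = 0) → μ t = 0} = Set.range ι := by
  classical
  obtain ⟨S⟩ := SkewData.exists_data (δ := δ) ι x hrep hcomm
  haveI : CharZero A := charZero_of_injective_algebraMap (algebraMap k A).injective
  ext t
  constructor
  · intro ht
    have h := ht S.D S.D_mul S.D_nil
    refine ⟨S.cf 0 t, (S.eq_i ?_).symm⟩
    intro i hi
    obtain ⟨i, rfl⟩ : ∃ i', i = i' + 1 := ⟨i - 1, by omega⟩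
    have e := S.cf_D i t
    rw [h, map_zero] at e
    exact (mul_eq_zero.mp e.symm).resolve_left (Nat.cast_ne_zero.mpr (by omega))
  · rintro ⟨a, rfl⟩ μ hμ hnil
    obtain ⟨m, hm⟩ := S.bound μ hμ hfg
    induction m with
    | zero => exact S.F_zero (hm.1 a)
    | succ m ih => exact ih (S.step μ hμ m hm.1 hm.2 hcomm hnil hML)
end

section
/- Let k be a field, let R be a finitely generated commutative k-algebra that is an integral domain of Krull dimension one, and let σ be a k-algebra automorphism of R that is not the identity. Let T be a skew polynomial ring R[x;σ]: a k-algebra with an injective k-algebra homomorphism ι : R → T and an element x ∈ T such that every element of T is uniquely a finite sum Σ_i ι(r_i)x^i and x·ι(r) = ι(σ(r))·x for all r ∈ R. If D is a commutative k-algebra which is an integral domain of Krull dimension one and there is a surjective k-algebra homomorphism T → D, then either D is isomorphic to R as a k-algebra, or there is a k-subalgebra K of D that is a field, finite-dimensional over k, with D isomorphic as a k-algebra to the polynomial ring K[x]. Moreover, there is a surjective k-algebra homomorphism from T onto R. -/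
theorem aux_dim {A : Type*} [CommRing A] [IsDomain A] (h : ringKrullDim A = 1) :
    Ring.DimensionLEOne A ∧ ¬ IsField A := by
  refine ⟨?_, fun hf => ?_⟩
  · have : Ring.KrullDimLE 1 A := by
      rw [Ring.krullDimLE_iff]; exact h.le
    exact Ring.krullDimLE_one_iff_of_noZeroDivisors.mp this |> fun h => ⟨fun {p} hp hpr => h p hp hpr⟩
  · rw [ringKrullDim_eq_zero_of_isField hf] at h
    exact zero_ne_one h

theorem aux_ker {A B : Type*} [CommRing A] [CommRing B] [IsDomain B]
    [Ring.DimensionLEOne A] (hB : ¬ IsField B) (f : A →+* B) (hf : Function.Surjective f) :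
    Function.Injective f := by
  rw [RingHom.injective_iff_ker_eq_bot]
  by_contra hne
  have hm : (RingHom.ker f).IsMaximal := Ring.DimensionLEOne.maximalOfPrime hne (RingHom.ker_isPrime f)
  apply hB
  exact (RingHom.quotientKerEquivOfSurjective hf).symm.toMulEquiv.isField
    ((Ideal.Quotient.maximal_ideal_iff_isField_quotient _).mp hm)

theorem aux_psi {k R T : Type*} [Field k]
    [CommRing R] [Algebra k R] [Ring T] [Algebra k T]
    (σ : R ≃ₐ[k] R) (ι : R →ₐ[k] T) (x : T)
    (hrep : ∀ t : T, ∃! b : ℕ →₀ R, t = b.sum fun i r => ι r * x ^ i)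
    (hcomm : ∀ r : R, x * ι r = ι (σ r) * x) :
    ∃ ψ : T →ₐ[k] R, Function.Surjective ψ := by
  have ex : ∀ t : T, ∃ r s, t = ι r + s * x := by
    intro t
    obtain ⟨b, rfl, -⟩ := hrep t
    induction b using Finsupp.induction_linear with
    | zero => exact ⟨0, 0, by simp⟩
    | add f g hf hg =>
      obtain ⟨r, s, h⟩ := hf
      obtain ⟨r', s', h'⟩ := hg
      refine ⟨r + r', s + s', ?_⟩
      rw [Finsupp.sum_add_index' (by simp) (by simp [add_mul]), h, h', map_add]
      noncomm_ring
    | single i a =>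
      rw [Finsupp.sum_single_index (by simp)]
      cases i with
      | zero => exact ⟨a, 0, by simp⟩
      | succ n => exact ⟨0, ι a * x ^ n, by simp [pow_succ, mul_assoc]⟩
  have un0 : ∀ r s, ι r = s * x → r = 0 := by
    intro r s h
    obtain ⟨b, hb, -⟩ := hrep s
    have h1 : ι r = (Finsupp.single 0 r).sum fun i r => ι r * x ^ i := by
      rw [Finsupp.sum_single_index (by simp)]; simp
    have h2 : ι r = (b.mapDomain Nat.succ).sum fun i r => ι r * x ^ i := by
      rw [Finsupp.sum_mapDomain_index (by simp) (by simp [add_mul]), h, hb, Finsupp.sum_mul]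
      simp [pow_succ, mul_assoc]
    have h3 := (hrep (ι r)).unique h1 h2
    have h4 := DFunLike.congr_fun h3 0
    rw [Finsupp.mapDomain_notin_range _ _ (by simp)] at h4
    simpa using h4
  choose ψ s hs using ex
  have un : ∀ t r s', t = ι r + s' * x → ψ t = r := by
    intro t r s' h
    rw [← sub_eq_zero]
    apply un0 _ (s' - s t)
    have := hs t
    rw [map_sub, sub_mul, sub_eq_sub_iff_add_eq_add, ← this, h, add_comm]
  have hx : ∀ t, ∃ u, x * t = u * x := by
    intro t
    refine ⟨ι (σ (ψ t)) + x * s t, ?_⟩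
    conv_lhs => rw [hs t]
    rw [mul_add, hcomm, add_mul, mul_assoc]
  refine ⟨{ toFun := ψ, map_one' := ?_, map_mul' := ?_, map_zero' := ?_, map_add' := ?_, commutes' := ?_ }, ?_⟩
  · exact un _ _ 0 (by simp)
  · intro a b
    obtain ⟨u, hu⟩ := hx b
    apply un _ _ (ι (ψ a) * s b + s a * u)
    calc a * b = (ι (ψ a) + s a * x) * b := by rw [← hs a]
      _ = ι (ψ a) * b + s a * (x * b) := by noncomm_ring
      _ = ι (ψ a) * (ι (ψ b) + s b * x) + s a * (u * x) := by rw [← hs b, hu]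
      _ = _ := by rw [map_mul]; noncomm_ring
  · exact un _ _ 0 (by simp)
  · intro a b
    apply un _ _ (s a + s b)
    calc a + b = (ι (ψ a) + s a * x) + (ι (ψ b) + s b * x) := by rw [← hs a, ← hs b]
      _ = _ := by rw [map_add]; noncomm_ring
  · intro c
    exact un _ _ 0 (by simp)
  · intro r
    exact ⟨ι r, un _ _ 0 (by simp)⟩


/-- Commutative domain images of Krull dimension one of a skew polynomial ring
`T = R[x; σ]` of automorphism type (`σ ≠ id`) over an affine commutative
domain `R` of Krull dimension one: any such image is either `R` or a
polynomial ring `K[x]` with `K/k` finite; moreover `R` itself is an image. -/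
theorem stmt_14 (k R T D : Type*) [Field k]
    [CommRing R] [IsDomain R] [Algebra k R] [Ring T] [Algebra k T]
    [CommRing D] [IsDomain D] [Algebra k D]
    (hfgR : Algebra.FiniteType k R) (hdimR : ringKrullDim R = 1)
    (σ : R ≃ₐ[k] R) (hσ : σ ≠ AlgEquiv.refl)
    (ι : R →ₐ[k] T) (hι : Function.Injective ι) (x : T)
    (hrep : ∀ t : T, ∃! b : ℕ →₀ R, t = b.sum fun i r => ι r * x ^ i)
    (hcomm : ∀ r : R, x * ι r = ι (σ r) * x)
    (hfgD : Algebra.FiniteType k D) (hdimD : ringKrullDim D = 1)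
    (φ : T →ₐ[k] D) (hφ : Function.Surjective φ) :
    (Nonempty (D ≃ₐ[k] R) ∨
      ∃ K : Subalgebra k D, IsField K ∧ FiniteDimensional k K ∧
        Nonempty (D ≃ₐ[k] Polynomial K)) ∧
    ∃ ψ : T →ₐ[k] R, Function.Surjective ψ := by
  refine ⟨?_, aux_psi σ ι x hrep hcomm⟩
  obtain ⟨hR1, hR⟩ := aux_dim hdimR
  obtain ⟨-, hD⟩ := aux_dim hdimD
  by_cases hx : φ x = 0
  · left
    have hsurj : Function.Surjective (φ.comp ι) := by
      intro d
      obtain ⟨t, rfl⟩ := hφ d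
      obtain ⟨b, rfl, -⟩ := hrep t
      refine ⟨b 0, ?_⟩
      rw [Finsupp.sum, map_sum, Finset.sum_eq_single 0]
      · simp
      · intro i _ hi
        simp [hx, hi]
      · intro h
        simp [Finsupp.notMem_support_iff.mp h]
    exact ⟨(AlgEquiv.ofBijective (φ.comp ι)
      ⟨aux_ker hD (φ.comp ι).toRingHom hsurj, hsurj⟩).symm⟩
  · right
    have hfix : ∀ r, φ (ι (σ r)) = φ (ι r) := by
      intro r
      have := congrArg φ (hcomm r)
      rw [map_mul, map_mul, mul_comm] at this
      exact (mul_right_cancel₀ hx this).symm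
    obtain ⟨r, hr⟩ : ∃ r, σ r ≠ r := by
      by_contra! h
      exact hσ (AlgEquiv.ext h)
    have hne : RingHom.ker (φ.comp ι).toRingHom ≠ ⊥ := by
      intro h
      have : σ r - r ∈ RingHom.ker (φ.comp ι).toRingHom := by
        rw [RingHom.mem_ker]
        simp [hfix]
      rw [h, Ideal.mem_bot, sub_eq_zero] at this
      exact hr this
    have hm := Ring.DimensionLEOne.maximalOfPrime hne (RingHom.ker_isPrime _)
    have hK : IsField (φ.comp ι).range :=
      (RingHom.quotientKerEquivRange (φ.comp ι).toRingHom).symm.toMulEquiv.isField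
        ((Ideal.Quotient.maximal_ideal_iff_isField_quotient _).mp hm)
    have hft : Algebra.FiniteType k (φ.comp ι).range :=
      hfgR.of_surjective (φ.comp ι).rangeRestrict (φ.comp ι).rangeRestrict_surjective
    refine ⟨(φ.comp ι).range, hK, ?_, ?_⟩
    · letI := hK.toField
      exact finite_of_finite_type_of_isJacobsonRing k (φ.comp ι).range
    · letI := hK.toField
      let f : Polynomial (φ.comp ι).range →ₐ[k] D :=
        (Polynomial.aeval (R := (φ.comp ι).range) (φ x)).restrictScalars k
      have hf : Function.Surjective f := by
        intro d
        obtain ⟨t, rfl⟩ := hφ d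
        obtain ⟨b, rfl, -⟩ := hrep t
        refine ⟨b.sum fun i r => Polynomial.C ((φ.comp ι).rangeRestrict r) * Polynomial.X ^ i, ?_⟩
        rw [Finsupp.sum, Finsupp.sum, map_sum, map_sum]
        refine Finset.sum_congr rfl fun i _ => ?_
        simp only [f, AlgHom.restrictScalars_apply, map_mul, map_pow, Polynomial.aeval_C, Polynomial.aeval_X]
        rfl
      have hp : IsPrincipalIdealRing (Polynomial (φ.comp ι).range) := inferInstance
      have : Ring.DimensionLEOne (Polynomial (φ.comp ι).range) := inferInstance
      exact ⟨(AlgEquiv.ofBijective f ⟨aux_ker hD f.toRingHom hf, hf⟩).symm⟩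
end
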